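/- arXiv:2603.12182 — 2 statements merged into one kernel-verified Lean document; each statement's English description precedes it below -/
import Mathlib

section
/- Let a ≥ 1, b > 1, μ > 0 satisfy a·max(μ, 1/μ) < b, and let V_ρ := diag(aμ, a/μ) and V_σ := b·I₂ be real 2×2 matrices. Then the Gaussian measured max-relative entropy D^G := sup { (1/2)·ln(det(V_σ + γ)/det(V_ρ + γ)) : γ real symmetric 2×2 with γ + iΩ₁ positive semidefinite } is given by the piecewise formula: D^G = F(z_opt) if μ_min < μ < μ_max; D^G = (1/2)·ln(bμ/a) if μ_max ≤ μ; and D^G = (1/2)·ln(b/(aμ)) if μ ≤ μ_min. -/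
open Matrix
open scoped ComplexOrder

noncomputable section

/-- The standard single-mode symplectic form. -/
def Omega1 : Matrix (Fin 2) (Fin 2) ℝ := !![0, 1; -1, 0]

/-- View a real matrix as a complex matrix. -/
def cplx {n : Type*} (M : Matrix n n ℝ) : Matrix n n ℂ :=
  M.map (fun x => (x : ℂ))

/-- `γ` is a bona fide single-mode quantum covariance matrix: `γ + iΩ₁ ≥ 0`. -/
def BonaFide1 (γ : Matrix (Fin 2) (Fin 2) ℝ) : Prop :=
  (cplx γ + Complex.I • cplx Omega1).PosSemidef

/-- The Gaussian measured max-relative entropy determined by single-mode covariance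
matrices `Vρ, Vσ`. -/
def GDmax (Vρ Vσ : Matrix (Fin 2) (Fin 2) ℝ) : ℝ :=
  sSup {x : ℝ | ∃ γ : Matrix (Fin 2) (Fin 2) ℝ, γ.IsSymm ∧ BonaFide1 γ ∧
    x = (1/2) * Real.log ((Vσ + γ).det / (Vρ + γ).det)}

/-- The optimal squeezing parameter of the measurement seed. -/
def zopt (a b μ : ℝ) : ℝ :=
  (a*b*(μ^2 - 1) + Real.sqrt ((a*b - μ)*(a*μ - b)*(a - b*μ)*(a*b*μ - 1)))
    / (a*(b^2 + 1) - (a^2 + 1)*b*μ)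

/- namespace_marker -/
/-- Extract the scalar content of bona-fideness. -/
lemma bonaFide_data (γ : Matrix (Fin 2) (Fin 2) ℝ) (hs : γ.IsSymm) (h : BonaFide1 γ) :
    0 ≤ γ 0 0 ∧ 0 ≤ γ 1 1 ∧ 1 ≤ γ 0 0 * γ 1 1 - γ 0 1 ^ 2 := by
  unfold BonaFide1 at h
  have h0 := h.diag_nonneg (i := 0)
  have h1 := h.diag_nonneg (i := 1)
  have hd := h.det_nonneg
  have hsy : γ 1 0 = γ 0 1 := hs.apply 0 1
  simp only [cplx, Omega1, Matrix.add_apply, Matrix.map_apply, Matrix.smul_apply] at h0 h1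
  rw [Matrix.det_fin_two] at hd
  simp only [cplx, Omega1, Matrix.add_apply, Matrix.map_apply, Matrix.smul_apply] at hd
  simp [hsy] at h0 h1 hd
  refine ⟨h0, h1, ?_⟩
  have e : (γ 0 0 : ℂ) * (γ 1 1 : ℂ) - ((γ 0 1 : ℂ) + Complex.I) * ((γ 0 1 : ℂ) + -Complex.I)
      = ((γ 0 0 * γ 1 1 - γ 0 1 ^ 2 - 1 : ℝ) : ℂ) := by
    push_cast
    linear_combination Complex.I_sq
  have hd2 : (0 : ℂ) ≤ (γ 0 0 : ℂ) * (γ 1 1 : ℂ)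
      - ((γ 0 1 : ℂ) + Complex.I) * ((γ 0 1 : ℂ) + -Complex.I) := by
    first
      | exact hd
      | exact sub_nonneg.mpr hd
  rw [e] at hd2
  have := Complex.zero_le_real.mp hd2
  linarith

/-- Pure squeezed seeds are bona fide. -/
lemma bonaFide_diag (z : ℝ) (hz : 0 < z) : BonaFide1 !![z, 0; 0, z⁻¹] := by
  unfold BonaFide1
  have hs : (Real.sqrt z : ℂ) * (Real.sqrt z : ℂ) = z := by
    rw [← Complex.ofReal_mul, Real.mul_self_sqrt hz.le]
  have hne : (Real.sqrt z : ℂ) ≠ 0 := by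
    exact_mod_cast (Real.sqrt_pos.mpr hz).ne'
  have key := Matrix.posSemidef_vecMulVec_self_star
    (![(Real.sqrt z : ℂ), -Complex.I * (Real.sqrt z : ℂ)⁻¹])
  convert key using 1
  ext i j
  fin_cases i <;> fin_cases j
  · simp [cplx, Omega1, Matrix.vecMulVec, hs]
  · simp [cplx, Omega1, Matrix.vecMulVec]
    field_simp
  · simp [cplx, Omega1, Matrix.vecMulVec]
    field_simp
  · simp [cplx, Omega1, Matrix.vecMulVec]
    rw [← hs]
    field_simp
    simp

/-- The upper bound. -/
lemma upper_bound (a b μ C : ℝ) (ha : 1 ≤ a) (hb : 1 < b) (hμ : 0 < μ) (hC : 1 ≤ C)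
    (H : ∀ x w : ℝ, 0 ≤ x → 0 ≤ w → 1 ≤ x * w →
      0 ≤ C * (1 + a ^ 2) - (1 + b ^ 2) + (C * a * μ - b) * w + (C * a / μ - b) * x)
    (γ : Matrix (Fin 2) (Fin 2) ℝ) (hs : γ.IsSymm) (h : BonaFide1 γ) :
    (1/2) * Real.log ((!![b, 0; 0, b] + γ).det / (!![a*μ, 0; 0, a/μ] + γ).det)
      ≤ (1/2) * Real.log C := by
  obtain ⟨h0, h1, hd⟩ := bonaFide_data γ hs h
  have hsy : γ 1 0 = γ 0 1 := hs.apply 0 1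
  have e1 : (!![b, 0; 0, b] + γ).det = (b + γ 0 0) * (b + γ 1 1) - γ 0 1 ^ 2 := by
    rw [Matrix.det_fin_two]; simp [hsy]; ring
  have e2 : (!![a*μ, 0; 0, a/μ] + γ).det
      = (a * μ + γ 0 0) * (a / μ + γ 1 1) - γ 0 1 ^ 2 := by
    rw [Matrix.det_fin_two]; simp [hsy]; ring
  rw [e1, e2]
  generalize γ 0 0 = x at *
  generalize γ 1 1 = w at *
  generalize γ 0 1 = y at *
  have hxw : 1 ≤ x * w := by nlinarith [sq_nonneg y]
  have hH := H x w h0 h1 hxw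
  have haa : (a * μ) * (a / μ) = a ^ 2 := by field_simp
  have q1 : 0 ≤ a * μ * w := by positivity
  have q2 : 0 ≤ a / μ * x := by positivity
  have hD : 0 < (a * μ + x) * (a / μ + w) - y ^ 2 := by nlinarith
  have hN : 0 < (b + x) * (b + w) - y ^ 2 := by
    nlinarith [mul_nonneg (by linarith : (0:ℝ) ≤ b) h0, mul_nonneg (by linarith : (0:ℝ) ≤ b) h1]
  have hle : ((b + x) * (b + w) - y ^ 2) / ((a * μ + x) * (a / μ + w) - y ^ 2) ≤ C := by
    rw [div_le_iff₀ hD]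
    have hh : 0 ≤ (C - 1) * (x * w - y ^ 2 - 1) := mul_nonneg (by linarith) (by linarith)
    have e3 : C * ((a * μ + x) * (a / μ + w) - y ^ 2)
        = C * (a ^ 2 + a * μ * w + a / μ * x + (x * w - y ^ 2)) := by
      rw [← haa]; ring
    have e4 : C * a / μ * x = C * (a / μ * x) := by ring
    rw [e3]
    nlinarith
  have := Real.log_le_log (div_pos hN hD) hle
  linarith

/-- Values of the seeds. -/
lemma seed_mem (a b μ z : ℝ) (ha : 1 ≤ a) (hμ : 0 < μ) (hz : 0 < z) :
    ∃ γ : Matrix (Fin 2) (Fin 2) ℝ, γ.IsSymm ∧ BonaFide1 γ ∧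
      (1/2) * Real.log (μ*(b + z)*(b*z + 1) / ((a*z + μ)*(a*μ + z)))
      = (1/2) * Real.log ((!![b, 0; 0, b] + γ).det / (!![a*μ, 0; 0, a/μ] + γ).det) := by
  refine ⟨!![z, 0; 0, z⁻¹], ?_, bonaFide_diag z hz, ?_⟩
  · ext i j
    fin_cases i <;> fin_cases j <;> simp
  · congr 2
    rw [Matrix.det_fin_two, Matrix.det_fin_two]
    simp
    have : 0 < a := by linarith
    field_simp

/-- The supremum from an upper bound and a limit of seeds. -/
lemma sup_limit (a b μ C : ℝ) (f : ℝ → ℝ) (hC : 0 < C) (hf0 : f 0 = C) (hf : ContinuousAt f 0)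
    (hub : ∀ γ : Matrix (Fin 2) (Fin 2) ℝ, γ.IsSymm → BonaFide1 γ →
      (1/2) * Real.log ((!![b, 0; 0, b] + γ).det / (!![a*μ, 0; 0, a/μ] + γ).det)
      ≤ (1/2) * Real.log C)
    (hm : ∀ t : ℝ, 0 < t → ∃ γ : Matrix (Fin 2) (Fin 2) ℝ, γ.IsSymm ∧ BonaFide1 γ ∧
      (1/2) * Real.log (f t)
      = (1/2) * Real.log ((!![b, 0; 0, b] + γ).det / (!![a*μ, 0; 0, a/μ] + γ).det)) :
    GDmax !![a*μ, 0; 0, a/μ] !![b, 0; 0, b] = (1/2) * Real.log C := by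
  unfold GDmax
  apply IsLUB.csSup_eq
  · constructor
    · rintro x ⟨γ, h1, h2, rfl⟩
      exact hub γ h1 h2
    · intro B hB
      have hc : Filter.Tendsto (fun t => (1/2) * Real.log (f t)) (nhdsWithin 0 (Set.Ioi 0))
          (nhds ((1/2) * Real.log C)) := by
        have : ContinuousAt (fun t => (1/2) * Real.log (f t)) 0 :=
          continuousAt_const.mul (hf.log (by rw [hf0]; exact hC.ne'))
        have h := this.tendsto
        rw [hf0] at h
        exact h.mono_left nhdsWithin_le_nhds
      refine le_of_tendsto hc ?_
      filter_upwards [self_mem_nhdsWithin] with t ht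
      exact hB (hm t ht)
  · obtain ⟨γ, h⟩ := hm 1 one_pos
    exact ⟨_, γ, h⟩

set_option maxHeartbeats 2000000

/-- the explicit piecewise formula for the Gaussian measured max-relative
entropy between a squeezed thermal state `V_ρ = diag(aμ, a/μ)` and a thermal state
`V_σ = b·I₂`. -/
theorem GDmax_single_mode_formula (a b μ : ℝ) (ha : 1 ≤ a) (hb : 1 < b) (hμ : 0 < μ)
    (hpd : a * max μ μ⁻¹ < b) :
    (b*(a^2+1)/(a*(b^2+1)) < μ → μ < a*(b^2+1)/(b*(a^2+1)) →
      GDmax !![a*μ, 0; 0, a/μ] !![b, 0; 0, b]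
        = (1/2) * Real.log (μ*(b + zopt a b μ)*(b*(zopt a b μ) + 1)
            / ((a*(zopt a b μ) + μ)*(a*μ + zopt a b μ)))) ∧
    (a*(b^2+1)/(b*(a^2+1)) ≤ μ →
      GDmax !![a*μ, 0; 0, a/μ] !![b, 0; 0, b] = (1/2) * Real.log (b*μ/a)) ∧
    (μ ≤ b*(a^2+1)/(a*(b^2+1)) →
      GDmax !![a*μ, 0; 0, a/μ] !![b, 0; 0, b] = (1/2) * Real.log (b/(a*μ))) := by
  have ha0 : 0 < a := by linarith
  have hb0 : 0 < b := by linarith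
  have h1 : a * μ < b := lt_of_le_of_lt (mul_le_mul_of_nonneg_left (le_max_left _ _) ha0.le) hpd
  have h2 : a < b * μ := by
    have : a * μ⁻¹ < b :=
      lt_of_le_of_lt (mul_le_mul_of_nonneg_left (le_max_right _ _) ha0.le) hpd
    rwa [← div_eq_mul_inv, div_lt_iff₀ hμ] at this
  have hab : a < b := by
    by_contra hcon
    push Not at hcon
    nlinarith
  refine ⟨?_, ?_, ?_⟩
  · intro hmin hmax
    rw [div_lt_iff₀ (by positivity)] at hmin
    rw [lt_div_iff₀ (by positivity)] at hmax
    set z := zopt a b μ with hzdef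
    set r := Real.sqrt ((a*b - μ)*(a*μ - b)*(a - b*μ)*(a*b*μ - 1)) with hr
    have hr0 : 0 ≤ r := Real.sqrt_nonneg _
    have hT : 0 < a*(b^2 + 1) - (a^2 + 1)*b*μ := by nlinarith
    have hS : 0 < a*μ^2*(b^2+1) - b*μ*(a^2+1) := by
      have : 0 < μ * (μ * (a * (b^2+1)) - b * (a^2+1)) := mul_pos hμ (by linarith)
      nlinarith
    have hTS := mul_pos hT hS
    have hrad : (a*b - μ)*(a*μ - b)*(a - b*μ)*(a*b*μ - 1) = (a*b*(μ^2-1))^2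
        + (a*(b^2 + 1) - (a^2 + 1)*b*μ) * (a*μ^2*(b^2+1) - b*μ*(a^2+1)) := by ring
    have hr2 : r ^ 2 = (a*b*(μ^2-1))^2
        + (a*(b^2 + 1) - (a^2 + 1)*b*μ) * (a*μ^2*(b^2+1) - b*μ*(a^2+1)) := by
      rw [hr, Real.sq_sqrt (by rw [hrad]; positivity), hrad]
    have hnum : 0 < a*b*(μ^2-1) + r := by
      have := abs_lt_of_sq_lt_sq (a := a*b*(μ^2-1)) (b := r) (by linarith) hr0
      linarith [(abs_lt.mp this).1]
    have hz : 0 < z := by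
      rw [hzdef]; unfold zopt; exact div_pos hnum hT
    have hzT : z * (a*(b^2 + 1) - (a^2 + 1)*b*μ) = a*b*(μ^2-1) + r := by
      rw [hzdef]; unfold zopt; rw [div_mul_cancel₀ _ hT.ne']
    have hquad : (a*(b^2 + 1) - (a^2 + 1)*b*μ) * z^2 - 2*(a*b*(μ^2-1))*z
        - (a*μ^2*(b^2+1) - b*μ*(a^2+1)) = 0 := by
      have hrr : r = z * (a*(b^2 + 1) - (a^2 + 1)*b*μ) - a*b*(μ^2-1) := by linarith
      rw [hrr] at hr2
      apply mul_left_cancel₀ hT.ne'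
      linear_combination hr2
    have hD : 0 < (a*z + μ)*(a*μ + z) := by positivity
    set C := μ*(b + z)*(b*z + 1) / ((a*z + μ)*(a*μ + z)) with hCdef
    have hCD : C * ((a*z + μ)*(a*μ + z)) = μ*(b + z)*(b*z + 1) := div_mul_cancel₀ _ hD.ne'
    have hC1 : 1 ≤ C := by
      rw [hCdef, le_div_iff₀ hD, one_mul]
      have := mul_le_mul (show a*μ + z ≤ b + z by linarith)
        (show a*z + μ ≤ μ*(b*z+1) by nlinarith) (by positivity) (by positivity)
      linarith
    have hqD : (C * a / μ - b) * ((a*z + μ)*(a*μ + z)) = r := by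
      have : (C * a / μ - b) * ((a*z + μ)*(a*μ + z))
          = a / μ * (C * ((a*z + μ)*(a*μ + z))) - b * ((a*z + μ)*(a*μ + z)) := by ring
      rw [this, hCD]
      have e : a / μ * (μ*(b + z)*(b*z + 1)) = a * (b+z)*(b*z+1) := by field_simp
      rw [e]
      linear_combination hzT
    have hq : 0 ≤ C * a / μ - b := by
      by_contra hcon
      push Not at hcon
      have := mul_neg_of_neg_of_pos hcon hD
      linarith
    have hp : C * a * μ - b = (C * a / μ - b) * z^2 := by
      apply mul_right_cancel₀ hD.ne'
      have e : (C * a / μ - b) * z^2 * ((a*z + μ)*(a*μ + z)) = r * z^2 := by rw [← hqD]; ring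
      rw [e]
      linear_combination (a*μ) * hCD - z * hquad + z^2 * hzT
    have hbal : C * (1 + a ^ 2) - (1 + b ^ 2) + 2 * (C * a / μ - b) * z = 0 := by
      have e1 : C * (a*z^2 + (a^2+1)*μ*z + a*μ^2) = μ*(b*z^2 + (b^2+1)*z + b) := by
        linear_combination hCD
      have e2 : C * a = (C * a / μ) * μ := by field_simp
      generalize C * a / μ = Q at *
      have hne : μ * z ≠ 0 := by positivity
      apply mul_left_cancel₀ hne
      linear_combination e1 - μ * hp + (-z^2-μ^2) * e2 + μ^2 * e2
    have hub := upper_bound a b μ C ha hb hμ hC1 (by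
      intro x w hx hw hxw
      rw [hp]
      have hx0 : 0 < x := by
        rcases hx.eq_or_lt with h | h
        · rw [← h] at hxw; norm_num at hxw
        · exact h
      have : 2 * z ≤ z^2 * w + x := by
        have : 2 * z * x ≤ (z^2 * w + x) * x := by
          nlinarith [sq_nonneg (z - x), mul_nonneg (sq_nonneg z) (sub_nonneg.mpr hxw)]
        exact le_of_mul_le_mul_right this hx0
      have := mul_le_mul_of_nonneg_left this hq
      linarith)
    unfold GDmax
    apply IsGreatest.csSup_eq
    refine ⟨seed_mem a b μ z ha hμ hz, ?_⟩
    rintro x ⟨γ, g1, g2, rfl⟩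
    exact hub γ g1 g2
  · intro hle
    rw [div_le_iff₀ (by positivity)] at hle
    have hb2 : 1 < b^2 := by nlinarith
    have hμ1 : 1 ≤ μ := by
      by_contra hcon
      push Not at hcon
      have hp1 : 0 < b * (a^2+1) := by positivity
      nlinarith [mul_pos (sub_pos.mpr hab) (show 0 < a * b - 1 by nlinarith)]
    apply sup_limit a b μ (b*μ/a)
      (fun t => μ*(b*t + 1)*(b + t) / ((a + μ*t)*(a*μ*t + 1))) (by positivity)
    · simp; ring
    · apply ContinuousAt.div (by fun_prop) (by fun_prop)
      simp; positivity
    · refine upper_bound a b μ _ ha hb hμ ?_ ?_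
      · rw [le_div_iff₀ ha0]; linarith
      · intro x w hx hw _
        have e1 : b*μ/a * a / μ - b = 0 := by field_simp; ring
        have e2 : b*μ/a * a * μ - b = b * (μ^2 - 1) := by field_simp
        have e3 : 0 ≤ b*μ/a * (1+a^2) - (1+b^2) := by
          rw [sub_nonneg, div_mul_eq_mul_div, le_div_iff₀ ha0]
          linarith
        rw [e1, e2]
        have : 0 ≤ b * (μ^2 - 1) * w := by
          apply mul_nonneg (mul_nonneg hb0.le _) hw
          nlinarith
        linarith
    · intro t ht
      have := seed_mem a b μ t⁻¹ ha hμ (by positivity)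
      have e : μ*(b + t⁻¹)*(b*t⁻¹ + 1) / ((a*t⁻¹ + μ)*(a*μ + t⁻¹))
          = μ*(b*t + 1)*(b + t) / ((a + μ*t)*(a*μ*t + 1)) := by
        field_simp
      rw [e] at this
      exact this
  · intro hle
    rw [le_div_iff₀ (by positivity)] at hle
    have hb2 : 1 < b^2 := by nlinarith
    have hμ1 : μ ≤ 1 := by
      by_contra hcon
      push Not at hcon
      have hp1 : 0 < a * (b^2+1) := by positivity
      nlinarith [mul_pos (sub_pos.mpr hab) (show 0 < a * b - 1 by nlinarith)]
    apply sup_limit a b μ (b/(a*μ))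
      (fun z => μ*(b + z)*(b*z + 1) / ((a*z + μ)*(a*μ + z))) (by positivity)
    · simp; field_simp
    · apply ContinuousAt.div (by fun_prop) (by fun_prop)
      simp; exact ⟨hμ.ne', ha0.ne', hμ.ne'⟩
    · refine upper_bound a b μ _ ha hb hμ ?_ ?_
      · rw [le_div_iff₀ (by positivity)]; linarith
      · intro x w hx hw _
        have e1 : b/(a*μ) * a * μ - b = 0 := by field_simp; ring
        have e2 : 0 ≤ b/(a*μ) * a / μ - b := by
          have : b/(a*μ) * a / μ = b / μ^2 := by field_simp
          rw [this, sub_nonneg, le_div_iff₀ (by positivity)]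
          nlinarith
        have e3 : 0 ≤ b/(a*μ) * (1+a^2) - (1+b^2) := by
          rw [sub_nonneg, div_mul_eq_mul_div, le_div_iff₀ (by positivity)]
          linarith
        rw [e1]
        have := mul_nonneg e2 hx
        linarith
    · intro t ht
      exact seed_mem a b μ t ha hμ ht
end
end

section
/- Fix κ > 1. For ε ∈ (0,1), set a(ε) := 1 + ε, b(ε) := 1 + κε, μ(ε) := 1 + (κ−1)ε(1−ε), V_ρ(ε) := diag(a(ε)μ(ε), a(ε)/μ(ε)), V_σ(ε) := b(ε)·I₂, and define D(ε) := sup { (1/2)·ln(det(V_σ(ε) + γ)/det(V_ρ(ε) + γ)) : γ real symmetric 2×2 with γ + iΩ₁ positive semidefinite }. Then: (1) for all sufficiently small ε > 0 one has a(ε)·max(μ(ε), 1/μ(ε)) < b(ε) and D(ε) = (1/2)·ln(b(ε)μ(ε)/a(ε)); and (2) D(ε)/ε → κ − 1 as ε → 0⁺ (limit along ε in (0,∞) tending to 0). -/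
open Matrix
open scoped ComplexOrder

noncomputable section

/-- The squeezing parameter `μ(ε) = 1 + (κ−1)ε(1−ε)` of the data-hiding family. -/
def muF (κ ε : ℝ) : ℝ := 1 + (κ - 1) * ε * (1 - ε)

/-- The Gaussian measured max-relative entropy `D(ε)` between the data-hiding states with
`V_ρ(ε) = diag((1+ε)μ(ε), (1+ε)/μ(ε))` and `V_σ(ε) = (1+κε)·I₂`. -/
def DF (κ ε : ℝ) : ℝ :=
  GDmax !![(1 + ε) * muF κ ε, 0; 0, (1 + ε) / muF κ ε]
    !![1 + κ * ε, 0; 0, 1 + κ * ε]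

lemma bona_fide_entries {γ : Matrix (Fin 2) (Fin 2) ℝ} (h : BonaFide1 γ) :
    0 ≤ γ 0 0 ∧ 0 ≤ γ 1 1 ∧ (γ.IsSymm → 1 ≤ γ 0 0 * γ 1 1 - γ 0 1 * γ 0 1) := by
  unfold BonaFide1 at h
  refine ⟨?_, ?_, fun hs => ?_⟩
  · have := h.diag_nonneg (i := 0)
    simpa [cplx, Omega1] using this
  · have := h.diag_nonneg (i := 1)
    simpa [cplx, Omega1] using this
  · have hd := h.det_nonneg
    have h10 : γ 1 0 = γ 0 1 := hs.apply 0 1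
    have e : (cplx γ + Complex.I • cplx Omega1).det
        = ((γ 0 0 * γ 1 1 - γ 0 1 * γ 0 1 - 1 : ℝ) : ℂ) := by
      rw [Matrix.det_fin_two]
      simp [cplx, Omega1, h10]
      ring_nf
      simp [Complex.I_sq]
      try ring
    rw [e] at hd
    have := Complex.zero_le_real.mp hd
    linarith

lemma bona_fide_diag (u : ℝ) (hu : 0 < u) :
    BonaFide1 !![(u ^ 2)⁻¹, 0; 0, u ^ 2] := by
  unfold BonaFide1
  have hc : (u : ℂ) ≠ 0 := by exact_mod_cast hu.ne'
  have e : cplx !![(u ^ 2)⁻¹, 0; 0, u ^ 2] + Complex.I • cplx Omega1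
      = (!![(u : ℂ)⁻¹, Complex.I * u; 0, 0])ᴴ * !![(u : ℂ)⁻¹, Complex.I * u; 0, 0] := by
    ext i j
    fin_cases i <;> fin_cases j <;>
      simp [cplx, Omega1, Matrix.mul_apply, Fin.sum_univ_two] <;> field_simp <;>
      simp [Complex.I_sq]
  rw [e]
  exact Matrix.posSemidef_conjTranspose_mul_self _

lemma gdmax_eq (b p q : ℝ) (hq : 0 < q) (hqp : q ≤ p) (hpb : p < b)
    (hk : b * q * (b - p) ≤ b - q) :
    GDmax !![p, 0; 0, q] !![b, 0; 0, b] = (1/2) * Real.log (b / q) := by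
  have hp : 0 < p := by linarith
  have hb : 0 < b := by linarith
  unfold GDmax
  apply IsLUB.csSup_eq
  · constructor
    · rintro x ⟨γ, hs, hγ, rfl⟩
      obtain ⟨hx, hy, hD⟩ := bona_fide_entries hγ
      have hD := hD hs
      have h10 : γ 1 0 = γ 0 1 := hs.apply 0 1
      rw [Matrix.det_fin_two, Matrix.det_fin_two]
      simp only [Matrix.add_apply, h10]
      simp
      generalize γ 0 0 = x at *
      generalize γ 1 1 = y at *
      generalize γ 0 1 = z at *
      have d1 : 0 < (b + x) * (b + y) - z * z := by nlinarith [mul_pos hb hb, mul_nonneg hb.le hx, mul_nonneg hb.le hy]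
      have d2 : 0 < (p + x) * (q + y) - z * z := by nlinarith [mul_pos hp hq, mul_nonneg hq.le hx, mul_nonneg hp.le hy]
      apply Real.log_le_log (div_pos d1 d2)
      rw [div_le_div_iff₀ d2 hq]
      have a1 : 0 ≤ b * y * (p - q) := by
        apply mul_nonneg (mul_nonneg hb.le hy); linarith
      have a2 : 0 ≤ (b - q) * (x * y - z * z - 1) := by
        apply mul_nonneg <;> linarith
      nlinarith
    · intro c hc
      have hcont : ContinuousAt (fun u : ℝ => (1/2) * Real.log
          (((b * u ^ 2 + 1) * (b + u ^ 2)) / ((p * u ^ 2 + 1) * (q + u ^ 2)))) 0 := by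
        have h1 : ((p * (0:ℝ) ^ 2 + 1) * (q + (0:ℝ) ^ 2)) ≠ 0 := by simp [hq.ne']
        refine ContinuousAt.mul continuousAt_const (ContinuousAt.log ?_ ?_)
        · exact ContinuousAt.div (by fun_prop) (by fun_prop) h1
        · simp [hq.ne', hb.ne']
      have ht := hcont.tendsto.mono_left (nhdsWithin_le_nhds (s := Set.Ioi 0))
      simp only [ne_eq, OfNat.ofNat_ne_zero, not_false_eq_true, zero_pow, mul_zero, zero_add,
        add_zero, one_mul] at ht
      refine le_of_tendsto ht ?_
      filter_upwards [self_mem_nhdsWithin] with u hu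
      have hu : 0 < u := hu
      apply hc
      refine ⟨!![(u ^ 2)⁻¹, 0; 0, u ^ 2], ?_, bona_fide_diag u hu, ?_⟩
      · ext i j
        fin_cases i <;> fin_cases j <;> rfl
      · congr 2
        rw [Matrix.det_fin_two, Matrix.det_fin_two]
        simp
        have : 0 < p * u ^ 2 + 1 := by positivity
        have : 0 < q + u ^ 2 := by positivity
        have : 0 < p + (u ^ 2)⁻¹ := by positivity
        rw [div_eq_div_iff (by positivity) (by positivity)]
        field_simp
  · exact ⟨_, _, by ext i j; fin_cases i <;> fin_cases j <;> rfl, bona_fide_diag 1 one_pos, rfl⟩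

lemma small_regime (κ ε : ℝ) (hκ : 1 < κ) (h0 : 0 < ε) (h1 : ε < 1 / (1 + κ)) :
    (1 + ε) * max (muF κ ε) (muF κ ε)⁻¹ < 1 + κ * ε ∧
      DF κ ε = (1/2) * Real.log ((1 + κ * ε) * muF κ ε / (1 + ε)) := by
  have hk1 : 0 < κ - 1 := by linarith
  have h2 : ε * (1 + κ) < 1 := by rwa [lt_div_iff₀ (by linarith)] at h1
  have h3 : ε < 1 / 2 := by nlinarith
  have hμ : 1 ≤ muF κ ε := by
    unfold muF
    have : 0 ≤ (κ - 1) * ε * (1 - ε) :=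
      mul_nonneg (mul_nonneg hk1.le h0.le) (by linarith)
    linarith
  have hp : (1 + κ * ε) - (1 + ε) * muF κ ε = (κ - 1) * ε ^ 3 := by
    unfold muF; ring
  have hpos : 0 < (κ - 1) * ε ^ 3 := by positivity
  have hμ0 : 0 < muF κ ε := by linarith
  constructor
  · rw [max_eq_left ((inv_le_one_of_one_le₀ hμ).trans hμ)]
    linarith
  · unfold DF
    rw [gdmax_eq]
    · rw [div_div_eq_mul_div]
    · positivity
    · rw [div_le_iff₀ hμ0]
      have : (1:ℝ) ≤ muF κ ε * muF κ ε := by nlinarith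
      nlinarith
    · linarith
    · rw [hp]
      have e1 : (1 + κ * ε) * ((1 + ε) / muF κ ε) * ((κ - 1) * ε ^ 3)
          = ((1 + κ * ε) * (1 + ε) * ((κ - 1) * ε ^ 3)) / muF κ ε := by ring
      rw [e1, div_le_iff₀ hμ0, sub_mul (1 + κ * ε), div_mul_cancel₀ _ hμ0.ne']
      have e2 : (1 + κ * ε) * (1 + ε) * ε ^ 2 ≤ 1 := by
        have : (1 + κ * ε) * (1 + ε) ≤ 2 * (3/2) := by
          apply mul_le_mul <;> nlinarith
        have : ε ^ 2 ≤ 1/4 := by nlinarith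
        calc _ ≤ (2 * (3/2)) * (1/4 : ℝ) := by
              apply mul_le_mul <;> first | assumption | positivity
          _ ≤ 1 := by norm_num
      have e3 : 0 ≤ (κ - 1) * ε := by positivity
      have e4 : 1 + κ * ε ≤ (1 + κ * ε) * muF κ ε := by
        apply le_mul_of_one_le_right _ hμ
        nlinarith
      nlinarith [mul_le_mul_of_nonneg_left e2 e3]

theorem data_hiding_expansion (κ : ℝ) (hκ : 1 < κ) :
    (∃ ε₀ : ℝ, 0 < ε₀ ∧ ε₀ ≤ 1 ∧ ∀ ε : ℝ, 0 < ε → ε < ε₀ →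
      ((1 + ε) * max (muF κ ε) (muF κ ε)⁻¹ < 1 + κ * ε ∧
        DF κ ε = (1/2) * Real.log ((1 + κ * ε) * muF κ ε / (1 + ε)))) ∧
    Filter.Tendsto (fun ε => DF κ ε / ε) (nhdsWithin 0 (Set.Ioi 0)) (nhds (κ - 1)) := by
  have hpos : 0 < 1 / (1 + κ) := by apply div_pos <;> linarith
  refine ⟨⟨1 / (1 + κ), hpos, ?_, fun ε h0 h1 => small_regime κ ε hκ h0 h1⟩, ?_⟩
  · rw [div_le_one (by linarith)]; linarith
  · have hid := hasDerivAt_id (0:ℝ)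
    have d1 : HasDerivAt (fun ε : ℝ => 1 + κ * ε) κ 0 := by
      simpa using (hid.const_mul κ).const_add 1
    have d3 : HasDerivAt (fun ε : ℝ => 1 + ε) 1 0 := by
      simpa using hid.const_add 1
    have d2 : HasDerivAt (fun ε : ℝ => muF κ ε) (κ - 1) 0 := by
      have := ((hid.const_mul (κ - 1)).mul (hid.const_sub 1)).const_add 1
      simpa [muF] using this
    have d := (((d1.mul d2).div d3 (by norm_num)).log (by simp [muF])).const_mul (1/2 : ℝ)
    have ds := d.tendsto_slope_zero_right
    have hlim : (1/2 : ℝ) * ((((κ * muF κ 0 + (1 + κ * 0) * (κ - 1)) * (1 + 0)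
        - ((1 + κ * 0) * muF κ 0) * 1) / (1 + 0) ^ 2) / ((1 + κ * 0) * muF κ 0 / (1 + 0)))
        = κ - 1 := by
      simp [muF]; ring
    have ds' : Filter.Tendsto (fun t : ℝ => t⁻¹ •
        ((1/2) * Real.log ((1 + κ * (0 + t)) * muF κ (0 + t) / (1 + (0 + t)))
          - (1/2) * Real.log ((1 + κ * 0) * muF κ 0 / (1 + 0))))
        (nhdsWithin 0 (Set.Ioi 0)) (nhds (κ - 1)) := by
      rw [← hlim]; exact ds
    refine ds'.congr' ?_
    filter_upwards [Ioo_mem_nhdsGT hpos] with ε hε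
    rw [(small_regime κ ε hκ hε.1 hε.2).2]
    simp [muF]
    ring
end
end
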